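/- Let b ≥ 2 be an integer base, let i ∈ I, and let n ≥ 2. Then K_i(n) = c·(b^{B(n)} + 1) + k for some integers c and k satisfying 1 ≤ c ≤ b−1 and 0 ≤ k ≤ (b−1)·B(n) − 2. Furthermore, if b is odd, then c ≤ (b−1)/2. -/

import Mathlib

namespace Kaprekar

/-- Sum of the digits of `v` in base `b`. -/
def s (b v : ℕ) : ℕ := (Nat.digits b v).sum

/-- `f v = v + s v`. -/
def f (b v : ℕ) : ℕ := v + s b v

/-- `F u` is the number of generators of `u`. -/
noncomputable def F (b u : ℕ) : ℕ := Set.ncard {v : ℕ | f b v = u}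

/-- `K n` is the least `u` with exactly `n` generators. -/
noncomputable def K (b n : ℕ) : ℕ := sInf {u : ℕ | F b u = n}

/-- `B n = ⌊log_b K(n)⌋`. -/
noncomputable def B (b n : ℕ) : ℕ := Nat.log b (K b n)

/-- `Ki i n` is the least `u ≡ i (mod b-1)` with exactly `n` generators. -/
noncomputable def Ki (b : ℕ) (i : ZMod (b - 1)) (n : ℕ) : ℕ :=
  sInf {u : ℕ | F b u = n ∧ (u : ZMod (b - 1)) = i}

/-- The index set `I`: all residues mod `b-1` if `b` is even, the even residues if `b` is odd. -/
def I (b : ℕ) : Set (ZMod (b - 1)) := {i | Even b ∨ ∃ j : ZMod (b - 1), i = 2 * j}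

theorem s_step (b v : ℕ) (hb : 2 ≤ b) : s b v = v % b + s b (v / b) := by
  rcases Nat.eq_zero_or_pos v with rfl | hv
  · simp [s]
  · simp [s, Nat.digits_def' hb hv]

theorem s_mul_add (b x r : ℕ) (hb : 2 ≤ b) (hr : r < b) : s b (b * x + r) = r + s b x := by
  rw [s_step b _ hb, Nat.mul_add_mod, Nat.mod_eq_of_lt hr, Nat.mul_add_div (by omega),
    Nat.div_eq_of_lt hr, add_zero]

theorem s_pos (b v : ℕ) (hb : 2 ≤ b) : 0 < v → 0 < s b v := by
  induction v using Nat.strong_induction_on with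
  | _ v ih =>
    intro hv
    rw [s_step b v hb]
    rcases Nat.eq_zero_or_pos (v / b) with h | h
    · have := Nat.div_add_mod v b
      rw [h] at this
      omega
    · have := ih (v / b) (Nat.div_lt_self hv (by omega)) h
      omega

/-- Prepending a leading digit `c` to a number with at most `m` digits. -/
theorem s_leading (b : ℕ) (hb : 2 ≤ b) (c : ℕ) (hc : c < b) (m : ℕ) :
    ∀ w < b ^ m, s b (c * b ^ m + w) = c + s b w := by
  induction m with
  | zero =>
    intro w hw
    obtain rfl : w = 0 := by simpa using hw
    have := s_mul_add b 0 c hb hc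
    simpa [s] using this
  | succ m ih =>
    intro w hw
    have hlt := Nat.mod_lt w (show 0 < b by omega)
    have hw' : w / b < b ^ m := Nat.div_lt_of_lt_mul (by rwa [pow_succ'] at hw)
    have e : c * b ^ (m + 1) + w = b * (c * b ^ m + w / b) + w % b := by
      conv_lhs => rw [← Nat.div_add_mod w b]
      ring
    rw [e, s_mul_add b _ _ hb hlt, ih _ hw', s_step b w hb]
    omega

/-- Complementing all `m` digits of `w`. -/
theorem s_compl (b : ℕ) (hb : 2 ≤ b) (m : ℕ) :
    ∀ w < b ^ m, s b (b ^ m - 1 - w) + s b w = (b - 1) * m := by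
  induction m with
  | zero =>
    intro w hw
    obtain rfl : w = 0 := by simpa using hw
    simp [s]
  | succ m ih =>
    intro w hw
    have hlt := Nat.mod_lt w (show 0 < b by omega)
    have hw' : w / b < b ^ m := Nat.div_lt_of_lt_mul (by rwa [pow_succ'] at hw)
    have e : b ^ (m + 1) - 1 - w = b * (b ^ m - 1 - w / b) + (b - 1 - w % b) := by
      obtain ⟨t, ht⟩ := Nat.exists_eq_add_of_lt hw'
      have hw2 := Nat.div_add_mod w b
      have h1 : b ^ m - 1 - w / b = t := by omega
      have h2 : b ^ (m + 1) = b * (w / b) + b * t + b := by rw [pow_succ', ht]; ring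
      rw [h1]
      omega
    have := ih _ hw'
    rw [e, s_mul_add b _ _ hb (by omega), s_step b w hb, mul_add]
    omega

theorem digit_bound (b : ℕ) (hb : 2 ≤ b) (m : ℕ) : (b - 1) * m + 1 ≤ b ^ m := by
  have := one_add_mul_le_pow (a := ((b : ℤ) - 1)) (by omega) m
  have hc : ((b - 1 : ℕ) : ℤ) = (b : ℤ) - 1 := by omega
  zify
  rw [hc]
  simp only [add_sub_cancel] at this
  linarith

theorem f_leading (b : ℕ) (hb : 2 ≤ b) (c : ℕ) (hc : c < b) (m w : ℕ) (hw : w < b ^ m) :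
    f b (c * b ^ m + w) = c * (b ^ m + 1) + f b w := by
  rw [f, f, s_leading b hb c hc m w hw]
  ring

theorem f_compl (b : ℕ) (hb : 2 ≤ b) (m w : ℕ) (hw : w < b ^ m) :
    f b (b ^ m - 1 - w) + f b w + 1 = b ^ m + (b - 1) * m := by
  have := s_compl b hb m w hw
  unfold f
  omega

theorem le_f (b v : ℕ) : v ≤ f b v := Nat.le_add_right _ _

theorem finite_f_add_eq (b a u : ℕ) : {v : ℕ | f b v + a = u}.Finite :=
  (Set.finite_Iic u).subset fun v hv => by
    have := le_f b v
    simp only [Set.mem_ofPred_eq] at hv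
    simp only [Set.mem_Iic]
    omega

/-- Splitting the generators of `c * (b ^ m + 1) + k` according to their leading digit. -/
theorem F_split (b : ℕ) (hb : 2 ≤ b) (m c k : ℕ) (hc1 : 1 ≤ c) (hc : c ≤ b - 1) (hk : k ≤ b ^ m)
    (hu : c * (b ^ m + 1) + k ≤ b ^ (m + 1)) :
    F b (c * (b ^ m + 1) + k) = F b k + {w : ℕ | f b w + (k + 2) = (b - 1) * m}.ncard := by
  obtain ⟨d, rfl⟩ : ∃ d, c = d + 1 := ⟨c - 1, by omega⟩
  have hdb := digit_bound b hb m
  have hlow : ∀ w, f b w = k → w < b ^ m := by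
    intro w hw
    have := le_f b w
    rcases lt_or_ge w (b ^ m) with h | h
    · exact h
    · have hp := s_pos b w hb (by omega)
      unfold f at hw
      omega
  have hlow' : ∀ w, f b w + (k + 2) = (b - 1) * m → w < b ^ m := by
    intro w hw
    have := le_f b w
    omega
  have hset : {v : ℕ | f b v = (d + 1) * (b ^ m + 1) + k} =
      (fun w => (d + 1) * b ^ m + w) '' {w | f b w = k} ∪
      (fun w => d * b ^ m + (b ^ m - 1 - w)) '' {w | f b w + (k + 2) = (b - 1) * m} := by
    ext v
    simp only [Set.mem_ofPred_eq, Set.mem_union, Set.mem_image]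
    constructor
    · intro hv
      have hvlt : v < b ^ m * b := by
        rw [← pow_succ]
        rcases lt_or_ge v (b ^ (m + 1)) with h | h
        · exact h
        · have hpp : 0 < b ^ (m + 1) := Nat.pow_pos (by omega)
          have hp := s_pos b v hb (by omega)
          unfold f at hv
          omega
      have hq : v / b ^ m < b := Nat.div_lt_of_lt_mul hvlt
      have hw : v % b ^ m < b ^ m := Nat.mod_lt _ (Nat.pow_pos (by omega))
      have hvv : v / b ^ m * b ^ m + v % b ^ m = v := Nat.div_add_mod' v (b ^ m)
      generalize v / b ^ m = q at *
      generalize v % b ^ m = w at *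
      subst hvv
      rw [f_leading b hb q hq m w hw] at hv
      have hcw := f_compl b hb m w hw
      have hcases : q = d + 1 ∨ q = d := by
        by_contra hne
        push Not at hne
        rcases lt_or_ge q d with h | h
        · obtain ⟨t, rfl⟩ := Nat.exists_eq_add_of_lt h
          have : (q + t + 1 + 1) * (b ^ m + 1) =
            q * (b ^ m + 1) + t * (b ^ m + 1) + 2 * (b ^ m + 1) := by ring
          omega
        · obtain ⟨t, rfl⟩ := Nat.exists_eq_add_of_le (show d + 2 ≤ q by omega)
          have : (d + 2 + t) * (b ^ m + 1) =
            (d + 1) * (b ^ m + 1) + t * (b ^ m + 1) + (b ^ m + 1) := by ring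
          omega
      rcases hcases with rfl | rfl
      · exact Or.inl ⟨w, by omega, rfl⟩
      · refine Or.inr ⟨b ^ m - 1 - w, ?_, by omega⟩
        rw [add_mul] at hv
        omega
    · rintro (⟨w, hw, rfl⟩ | ⟨w, hw, rfl⟩)
      · rw [f_leading b hb _ (by omega) m w (hlow w hw), hw]
      · have hwl := hlow' w hw
        rw [f_leading b hb _ (by omega) m _ (by omega), add_mul]
        have := f_compl b hb m w hwl
        omega
  have hfin : {w : ℕ | f b w = k}.Finite := finite_f_add_eq b 0 k
  unfold F
  rw [hset, Set.ncard_union_eq _ (hfin.image _) ((finite_f_add_eq b _ _).image _),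
    Set.InjOn.ncard_image, Set.InjOn.ncard_image]
  · intro x hx y hy hxy
    have := hlow' x hx
    have := hlow' y hy
    simp only at hxy
    omega
  · intro x _ y _ hxy
    simpa using hxy
  · rw [Set.disjoint_left]
    rintro v ⟨x, _, rfl⟩ ⟨y, hy, hxy⟩
    have := hlow' y hy
    simp only [add_mul] at hxy
    omega

theorem F_pow (b : ℕ) (hb : 2 ≤ b) (m : ℕ) :
    F b (b ^ m) = {w : ℕ | f b w + 1 = (b - 1) * m}.ncard := by
  have hdb := digit_bound b hb m
  have hlow' : ∀ w, f b w + 1 = (b - 1) * m → w < b ^ m := by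
    intro w hw
    have := le_f b w
    omega
  have hset : {v : ℕ | f b v = b ^ m} =
      (fun w => b ^ m - 1 - w) '' {w | f b w + 1 = (b - 1) * m} := by
    ext v
    simp only [Set.mem_ofPred_eq, Set.mem_image]
    constructor
    · intro hv
      have hvlt : v < b ^ m := by
        rcases lt_or_ge v (b ^ m) with h | h
        · exact h
        · have hp := s_pos b v hb (by omega)
          unfold f at hv
          omega
      have := f_compl b hb m v hvlt
      exact ⟨b ^ m - 1 - v, by omega, by omega⟩
    · rintro ⟨w, hw, rfl⟩
      have := f_compl b hb m w (hlow' w hw)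
      omega
  unfold F
  rw [hset, Set.InjOn.ncard_image]
  intro x hx y hy hxy
  have := hlow' x hx
  have := hlow' y hy
  simp only at hxy
  omega

theorem ncard_f_add_eq (b a t : ℕ) (h : a ≤ t) : {w : ℕ | f b w + a = t}.ncard = F b (t - a) := by
  unfold F
  congr 1
  ext w
  simp only [Set.mem_ofPred_eq]
  omega

theorem ncard_f_add_eq_zero (b a t : ℕ) (h : t < a) : {w : ℕ | f b w + a = t}.ncard = 0 := by
  have : {w : ℕ | f b w + a = t} = ∅ := by
    ext w
    simp only [Set.mem_ofPred_eq, Set.mem_empty_iff_false, iff_false]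
    omega
  simp [this]

theorem f_of_lt (b w : ℕ) (hb : 2 ≤ b) (hw : w < b) : f b w = 2 * w := by
  have := s_mul_add b 0 w hb hw
  simp [s] at this
  simp [f, s, this]
  omega

theorem F_le_of_lt (b x : ℕ) (hb : 2 ≤ b) (hx : x < b) : F b x + x % 2 ≤ 1 := by
  have hsub : {v : ℕ | f b v = x} ⊆ {v | v = x / 2 ∧ x % 2 = 0} := by
    intro v hv
    simp only [Set.mem_ofPred_eq] at hv ⊢
    have := le_f b v
    rw [f_of_lt b v hb (by omega)] at hv
    omega
  unfold F
  rcases Nat.mod_two_eq_zero_or_one x with h | h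
  · have h2 : {v : ℕ | f b v = x}.ncard ≤ ({x / 2} : Set ℕ).ncard :=
      Set.ncard_le_ncard (fun v hv => (hsub hv).1) (Set.finite_singleton _)
    rw [Set.ncard_singleton] at h2
    omega
  · have h2 : {v : ℕ | f b v = x} = ∅ :=
      Set.eq_empty_of_forall_notMem fun v hv => by
        have := (hsub hv).2
        omega
    rw [h2, Set.ncard_empty, h]

theorem cast_base (b : ℕ) (hb : 2 ≤ b) : (b : ZMod (b - 1)) = 1 := by
  have h : (((b - 1) + 1 : ℕ) : ZMod (b - 1)) = 1 := by
    rw [Nat.cast_add, ZMod.natCast_self]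
    simp
  rwa [Nat.sub_add_cancel (by omega)] at h

theorem cast_f (b v : ℕ) (hb : 2 ≤ b) : (f b v : ZMod (b - 1)) = 2 * (s b v : ZMod (b - 1)) := by
  have h : (v : ZMod (b - 1)) = (s b v : ZMod (b - 1)) := by
    conv_lhs => rw [← Nat.ofDigits_digits b v, Nat.coe_ofDigits, cast_base b hb]
    rw [s, ← Nat.ofDigits_one, Nat.coe_ofDigits, Nat.cast_one]
  rw [f, Nat.cast_add, h]
  ring

theorem exists_pos_modEq (N z : ℕ) (hN : 1 ≤ N) : ∃ c, 1 ≤ c ∧ c ≤ N ∧ c ≡ z [MOD N] := by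
  have hlt := Nat.mod_lt z (show N > 0 from hN)
  rcases Nat.eq_zero_or_pos (z % N) with h | h
  · exact ⟨N, hN, le_rfl, by simp [Nat.ModEq, h]⟩
  · exact ⟨z % N, h, hlt.le, Nat.mod_modEq z N⟩

theorem exists_digit_two_mul (b : ℕ) (hb : 2 ≤ b) (y : ZMod (b - 1)) :
    ∃ c : ℕ, 1 ≤ c ∧ c ≤ b - 1 ∧ (Odd b → 2 * c ≤ b - 1) ∧ 2 * (c : ZMod (b - 1)) = 2 * y := by
  have : NeZero (b - 1) := ⟨by omega⟩
  have key : ∀ c : ℕ, 2 * c ≡ 2 * y.val [MOD (b - 1)] → 2 * (c : ZMod (b - 1)) = 2 * y := by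
    intro c h
    have h2 := (ZMod.natCast_eq_natCast_iff _ _ _).2 h
    rw [Nat.cast_mul, Nat.cast_mul, ZMod.natCast_zmod_val] at h2
    exact_mod_cast h2
  rcases Nat.even_or_odd b with he | ho
  · obtain ⟨c, h1, h2, h3⟩ := exists_pos_modEq (b - 1) y.val (by omega)
    exact ⟨c, h1, h2, fun h => absurd he (Nat.not_even_iff_odd.2 h), key c (h3.mul_left 2)⟩
  · obtain ⟨e, rfl⟩ := ho
    obtain ⟨c, h1, h2, h3⟩ := exists_pos_modEq e y.val (by omega)
    exact ⟨c, h1, by omega, fun _ => by omega, key c (h3.mul_left' 2)⟩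

theorem exists_two_mul_of_even (b : ℕ) (hb : 2 ≤ b) (he : Even b) (x : ZMod (b - 1)) :
    ∃ y, x = 2 * y := by
  obtain ⟨e, he⟩ := he
  refine ⟨(e : ZMod (b - 1)) * x, ?_⟩
  have h := cast_base b hb
  have h2 : (b : ZMod (b - 1)) = 2 * (e : ZMod (b - 1)) := by
    have h3 := congrArg (Nat.cast : ℕ → ZMod (b - 1)) he
    rw [h3, Nat.cast_add]
    ring
  rw [← mul_assoc, ← h2, h, one_mul]

theorem cast_mul_pow_add_one (b : ℕ) (hb : 2 ≤ b) (m c k : ℕ) :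
    ((c * (b ^ m + 1) + k : ℕ) : ZMod (b - 1)) = 2 * c + k := by
  push_cast
  rw [cast_base b hb, one_pow]
  ring

/-- Numbers `c * (b ^ m + 1) + k` with `k` in the range of the theorem have at most `m + 1` digits,
or equal `b ^ (m + 1)`, unless `b` is even and `m = 1`. -/
theorem leading_bound (b : ℕ) (hb : 2 ≤ b) (m c k : ℕ) (hc : c ≤ b - 1)
    (hodd : Odd b → 2 * c ≤ b - 1) (hm : Even b → 2 ≤ m) (hk : k + 2 ≤ (b - 1) * m) :
    c * (b ^ m + 1) + k ≤ b ^ (m + 1) := by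
  have hdb := digit_bound b hb m
  have hP : 1 ≤ b ^ m := Nat.one_le_pow _ _ (by omega)
  obtain ⟨a, rfl⟩ : ∃ a, b = a + 1 := ⟨b - 1, by omega⟩
  simp only [Nat.add_sub_cancel] at *
  rw [pow_succ]
  rcases Nat.even_or_odd (a + 1) with he | ho
  · have hm2 := hm he
    have hq : a * (m + 1) ≤ (a + 1) ^ m + 2 := by
      clear hP hdb hk hm
      induction m, hm2 using Nat.le_induction with
      | base => nlinarith [sq_nonneg ((a : ℤ) - 1)]
      | succ m _ ih =>
        have hP : 1 ≤ (a + 1) ^ m := Nat.one_le_pow _ _ (by omega)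
        rw [pow_succ]
        nlinarith
    nlinarith [Nat.mul_le_mul_right ((a + 1) ^ m + 1) hc]
  · have := hodd ho
    nlinarith [Nat.mul_le_mul_right ((a + 1) ^ m + 1) this]

theorem stmt13 (b : ℕ) (hb : 2 ≤ b) (i : ZMod (b - 1)) (hi : i ∈ I b) (n : ℕ) (hn : 2 ≤ n)
    (hex : ∀ m, 1 ≤ m → ∀ j ∈ I b, ∃ u : ℕ, F b u = m ∧ (u : ZMod (b - 1)) = j) :
    ∃ c k : ℕ, 1 ≤ c ∧ c ≤ b - 1 ∧ (Odd b → 2 * c ≤ b - 1) ∧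
      (k : ℤ) ≤ ((b : ℤ) - 1) * B b n - 2 ∧
      Ki b i n = c * (b ^ B b n + 1) + k := by
  have hIzero : (0 : ZMod (b - 1)) ∈ I b := Or.inr ⟨0, by simp⟩
  have hne : {u : ℕ | F b u = n}.Nonempty := by
    obtain ⟨u, hu, -⟩ := hex n (by omega) 0 hIzero
    exact ⟨u, hu⟩
  have hKF : F b (K b n) = n := Nat.sInf_mem hne
  have hKmin : ∀ u, F b u = n → K b n ≤ u := fun u hu => Nat.sInf_le hu
  have hK0 : K b n ≠ 0 := by
    intro h
    have := F_le_of_lt b 0 hb (by omega)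
    rw [h] at hKF
    omega
  have hlo : b ^ B b n ≤ K b n := Nat.pow_log_le_self b hK0
  have hhi : K b n < b ^ (B b n + 1) := Nat.lt_pow_succ_log_self (by omega) _
  generalize B b n = m at *
  have hdb := digit_bound b hb m
  have hP : 1 ≤ b ^ m := Nat.one_le_pow _ _ (by omega)
  have hKgt : b ^ m + 1 ≤ K b n := by
    rcases hlo.lt_or_eq with h | h
    · exact h
    · exfalso
      rw [← h, F_pow b hb] at hKF
      rcases Nat.lt_or_ge ((b - 1) * m) 1 with h1 | h1
      · rw [ncard_f_add_eq_zero _ _ _ h1] at hKF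
        omega
      · rw [ncard_f_add_eq _ _ _ h1] at hKF
        have := hKmin _ hKF
        omega
  have hsmall : ∀ c k, 1 ≤ c → c ≤ b - 1 → k ≤ b ^ m → c * (b ^ m + 1) + k ≤ b ^ (m + 1) →
      F b (c * (b ^ m + 1) + k) = n → k + 2 ≤ (b - 1) * m := by
    intro c k h1 h2 h3 h4 h5
    by_contra hcon
    rw [F_split b hb m c k h1 h2 h3 h4, ncard_f_add_eq_zero _ _ _ (by omega), add_zero] at h5
    have := hKmin _ h5
    omega
  have hdecomp : ∀ u, ∃ c k, u = c * (b ^ m + 1) + k ∧ k ≤ b ^ m := fun u =>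
    ⟨u / (b ^ m + 1), u % (b ^ m + 1), (Nat.div_add_mod' _ _).symm,
      Nat.le_of_lt_succ (Nat.mod_lt _ (by omega))⟩
  have hpos : ∀ c k, k ≤ b ^ m → b ^ m + 1 ≤ c * (b ^ m + 1) + k → 1 ≤ c := by
    intro c k h1 h2
    rcases Nat.eq_zero_or_pos c with rfl | h
    · omega
    · exact h
  obtain ⟨c₀, k₀, hK, hk₀⟩ := hdecomp (K b n)
  rw [hK] at hKF hhi hKgt
  have hc₀ := hpos c₀ k₀ hk₀ hKgt
  have hc₀' : c₀ ≤ b - 1 := by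
    by_contra hcon
    have := Nat.mul_le_mul_right (b ^ m + 1) (show b ≤ c₀ by omega)
    rw [pow_succ'] at hhi
    nlinarith
  have hk₀' := hsmall c₀ k₀ hc₀ hc₀' hk₀ hhi.le hKF
  have hsplit := F_split b hb m c₀ k₀ hc₀ hc₀' hk₀ hhi.le
  have hm : Even b → 2 ≤ m := by
    intro he
    by_contra hcon
    obtain rfl | rfl : m = 0 ∨ m = 1 := by omega
    · omega
    · rw [hKF, ncard_f_add_eq _ _ _ hk₀'] at hsplit
      have h1 := F_le_of_lt b k₀ hb (by omega)
      have h2 := F_le_of_lt b ((b - 1) * 1 - (k₀ + 2)) hb (by omega)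
      obtain ⟨e, he⟩ := he
      omega
  obtain ⟨y, hy⟩ : ∃ y, i - (k₀ : ZMod (b - 1)) = 2 * y := by
    rcases hi with he | ⟨j, rfl⟩
    · exact exists_two_mul_of_even b hb he _
    · obtain ⟨v, hv⟩ : {v : ℕ | f b v = c₀ * (b ^ m + 1) + k₀}.Nonempty :=
        Set.nonempty_of_ncard_ne_zero (by unfold F at hKF; omega)
      simp only [Set.mem_ofPred_eq] at hv
      have h := cast_f b v hb
      rw [hv, cast_mul_pow_add_one b hb] at h
      exact ⟨j - s b v + c₀, by linear_combination -h⟩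
  obtain ⟨c₁, h1, h2, h3, h4⟩ := exists_digit_two_mul b hb y
  have hbd := leading_bound b hb m c₁ k₀ h2 h3 hm hk₀'
  have hF₁ : F b (c₁ * (b ^ m + 1) + k₀) = n := by
    rw [F_split b hb m c₁ k₀ h1 h2 hk₀ hbd, ← hsplit, hKF]
  have hmem : c₁ * (b ^ m + 1) + k₀ ∈ {u : ℕ | F b u = n ∧ (u : ZMod (b - 1)) = i} := by
    refine ⟨hF₁, ?_⟩
    rw [cast_mul_pow_add_one b hb, h4, ← hy]
    ring
  have hKi : F b (Ki b i n) = n := (Nat.sInf_mem ⟨_, hmem⟩).1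
  have hKile : Ki b i n ≤ c₁ * (b ^ m + 1) + k₀ := Nat.sInf_le hmem
  have hKige := hKmin _ hKi
  obtain ⟨c, k, hck, hk⟩ := hdecomp (Ki b i n)
  rw [hck] at hKi hKile hKige
  have hcc : c ≤ c₁ := by
    by_contra hcon
    have := Nat.mul_le_mul_right (b ^ m + 1) (show c₁ + 1 ≤ c by omega)
    rw [add_mul] at this
    omega
  have hc := hpos c k hk (by omega)
  have hk' := hsmall c k hc (by omega) hk (by omega) hKi
  refine ⟨c, k, hc, by omega, fun ho => by have := h3 ho; omega, ?_, hck⟩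
  have hcast : ((b - 1 : ℕ) : ℤ) = (b : ℤ) - 1 := by omega
  rw [← hcast]
  have : ((k + 2 : ℕ) : ℤ) ≤ ((b - 1) * m : ℕ) := by exact_mod_cast hk'
  push_cast at this ⊢
  linarith

end Kaprekar
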